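/- Let β be a Gaussian random vector in ℝ^m with mean 0 and covariance Σ, let v ∈ ℝ^m and c ∈ ℝ with v'Σv > 0. Then P(|v'β − c| < Δ) ≥ P(X − Y ≥ 2), where X ~ Poisson(Δ₁/2) and Y ~ Poisson(λ/2) are independent, Δ₁ = Δ²/(v'Σv), λ = c²/(v'Σv). -/

import Mathlib

open MeasureTheory ProbabilityTheory Real
open scoped NNReal Matrix

open Set Filter Topology
open scoped Nat

/-- A function on `[0, ∞)` that starts at `0`, increases up to `x₀`, then decreases to the limit `0`
is nonnegative. -/
lemma nonneg_of_deriv_sign_change {h h' : ℝ → ℝ} {x₀ : ℝ}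
    (hd : ∀ x, HasDerivAt h (h' x) x) (h0 : h 0 = 0)
    (hpos : ∀ x, 0 < x → x < x₀ → 0 ≤ h' x) (hneg : ∀ x, 0 < x → x₀ < x → h' x ≤ 0)
    (hlim : Tendsto h atTop (𝓝 0)) (hx₀ : 0 ≤ x₀) {x : ℝ} (hx : 0 ≤ x) : 0 ≤ h x := by
  have hc : Continuous h := continuous_iff_continuousAt.2 fun x => (hd x).continuousAt
  rcases le_total x x₀ with hxx | hxx
  · have hm : MonotoneOn h (Icc 0 x₀) := by
      refine monotoneOn_of_hasDerivWithinAt_nonneg (convex_Icc _ _) hc.continuousOn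
        (fun y _ => (hd y).hasDerivWithinAt) fun y hy => ?_
      rw [interior_Icc] at hy
      exact hpos y hy.1 hy.2
    have := hm (left_mem_Icc.2 hx₀) ⟨hx, hxx⟩ hx
    rwa [h0] at this
  · have hm : AntitoneOn h (Ici x₀) := by
      refine antitoneOn_of_hasDerivWithinAt_nonpos (convex_Ici _) hc.continuousOn
        (fun y _ => (hd y).hasDerivWithinAt) fun y hy => ?_
      rw [interior_Ici] at hy
      exact hneg y (hx₀.trans_lt hy) hy
    refine le_of_tendsto hlim ?_
    filter_upwards [eventually_ge_atTop x] with y hy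
    exact hm hxx (hxx.trans hy) hy

lemma hasDerivAt_sum_poisson (n : ℕ) (r : ℝ) :
    HasDerivAt (fun r : ℝ => ∑ j ∈ Finset.range (n + 1), exp (-r) * r ^ j / j !)
      (-(exp (-r) * r ^ n / n !)) r := by
  have hexp : HasDerivAt (fun r : ℝ => exp (-r)) (-exp (-r)) r := by
    simpa using (hasDerivAt_neg r).exp
  induction n with
  | zero => simpa using hexp
  | succ n ih =>
    simp_rw [Finset.sum_range_succ _ (n + 1)]
    refine (ih.add ((hexp.mul (hasDerivAt_pow (n + 1) r)).div_const ((n + 1)! : ℝ))).congr_deriv ?_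
    rw [Nat.factorial_succ]
    push_cast
    field_simp
    simp

lemma tendsto_sum_poisson_atTop (n : ℕ) :
    Tendsto (fun r : ℝ => ∑ j ∈ Finset.range n, exp (-r) * r ^ j / j !) atTop (𝓝 0) := by
  rw [← Finset.sum_const_zero (s := Finset.range n)]
  refine tendsto_finsetSum _ fun j _ => ?_
  simpa [mul_comm] using (Real.tendsto_pow_mul_exp_neg_atTop_nhds_zero j).div_const (j ! : ℝ)

lemma Real.Gamma_nat_add_half_eq_factorial (k : ℕ) :
    Real.Gamma (k + 1 / 2) = (2 * k)! * √π / (4 ^ k * k !) := by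
  induction k with
  | zero => simp [Gamma_one_half_eq, -one_div]
  | succ k ih =>
    rw [show ((k + 1 : ℕ) : ℝ) + 1 / 2 = (k + 1 / 2 : ℝ) + 1 by push_cast; ring,
      Real.Gamma_add_one (by positivity), ih, show 2 * (k + 1) = 2 * k + 1 + 1 by ring,
      Nat.factorial_succ, Nat.factorial_succ, Nat.factorial_succ]
    push_cast
    field_simp
    ring

lemma integrableOn_pow_mul_exp_neg_sq_div_two (n : ℕ) :
    IntegrableOn (fun x : ℝ => x ^ n * exp (-(x ^ 2 / 2))) (Ioi 0) := by
  have h := integrableOn_rpow_mul_exp_neg_mul_sq (b := 1 / 2) (by norm_num)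
    (s := n) (by linarith [n.cast_nonneg (α := ℝ)])
  refine h.congr_fun (fun x _ => ?_) measurableSet_Ioi
  simp only [rpow_natCast]
  ring_nf

lemma integral_pow_mul_exp_neg_sq_div_two (k : ℕ) :
    ∫ x in Ioi (0 : ℝ), x ^ (2 * k) * exp (-(x ^ 2 / 2)) =
      √(2 * π) / 2 * ((2 * k)! / (2 ^ k * k !)) := by
  have h := integral_rpow_mul_exp_neg_mul_rpow (p := 2) (q := (2 * k : ℕ)) (b := 1 / 2)
    (by norm_num) (by linarith [(2 * k).cast_nonneg (α := ℝ)]) (by norm_num)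
  have he : ((2 * k : ℕ) + 1 : ℝ) / 2 = k + 1 / 2 := by push_cast; ring
  rw [neg_div, he, Real.Gamma_nat_add_half_eq_factorial, one_div, inv_rpow (by norm_num),
    rpow_neg (by norm_num), inv_inv, rpow_add (by norm_num), rpow_natCast,
    ← one_div, ← sqrt_eq_rpow] at h
  rw [Real.sqrt_mul (by norm_num)]
  calc _ = ∫ x in Ioi (0 : ℝ), x ^ ((2 * k : ℕ) : ℝ) * exp (-(1 / 2) * x ^ (2 : ℝ)) := by
        refine setIntegral_congr_fun measurableSet_Ioi fun x _ => ?_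
        simp only [rpow_natCast, rpow_two]
        ring_nf
    _ = _ := by
        rw [h, show (4 : ℝ) = 2 * 2 by norm_num, mul_pow]
        field_simp

/-- The distribution function of the chi distribution with `2k + 1` degrees of freedom dominates
that of the chi distribution with `2k + 2` degrees of freedom. -/
lemma one_sub_sum_poisson_le_integral (k : ℕ) {a : ℝ} (ha : 0 ≤ a) :
    1 - ∑ j ∈ Finset.range (k + 1), exp (-(a ^ 2 / 2)) * (a ^ 2 / 2) ^ j / j ! ≤
      2 / √(2 * π) * (2 ^ k * k ! / (2 * k)!) *
        ∫ x in (0 : ℝ)..a, x ^ (2 * k) * exp (-(x ^ 2 / 2)) := by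
  set C : ℝ := 2 / √(2 * π) * (2 ^ k * k ! / (2 * k)!) with hC
  have hC0 : 0 < C := by positivity
  have hcont : Continuous fun x : ℝ => x ^ (2 * k) * exp (-(x ^ 2 / 2)) := by fun_prop
  have hsq (x : ℝ) : HasDerivAt (fun x : ℝ => x ^ 2 / 2) x x := by
    simpa using (hasDerivAt_pow 2 x).div_const 2
  have hd (x : ℝ) := ((hcont.integral_hasStrictDerivAt 0 x).hasDerivAt.const_mul C).sub
    (((hasDerivAt_sum_poisson k (x ^ 2 / 2)).comp x (hsq x)).const_sub 1)
  have hfac (x : ℝ) : C * (x ^ (2 * k) * exp (-(x ^ 2 / 2))) -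
      -(-(exp (-(x ^ 2 / 2)) * (x ^ 2 / 2) ^ k / k !) * x) =
      x ^ (2 * k) * exp (-(x ^ 2 / 2)) / (2 ^ k * k !) * (C * (2 ^ k * k !) - x) := by
    rw [div_pow, ← pow_mul]
    field_simp
  have hnn (x : ℝ) : 0 ≤ x ^ (2 * k) * exp (-(x ^ 2 / 2)) / (2 ^ k * k !) := by
    have : 0 ≤ x ^ (2 * k) := (even_two_mul k).pow_nonneg x
    positivity
  have := nonneg_of_deriv_sign_change (x₀ := C * (2 ^ k * k !)) hd ?_ ?_ ?_ ?_ (by positivity) ha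
  · simpa using this
  · simp [Finset.sum_range_succ']
  · intro x _ hx
    rw [hfac]
    exact mul_nonneg (hnn x) (by linarith)
  · intro x _ hx
    rw [hfac]
    exact mul_nonpos_of_nonneg_of_nonpos (hnn x) (by linarith)
  · have h1 := (intervalIntegral_tendsto_integral_Ioi 0
      (integrableOn_pow_mul_exp_neg_sq_div_two (2 * k)) tendsto_id).const_mul C
    rw [integral_pow_mul_exp_neg_sq_div_two] at h1
    have h2 : Tendsto (fun x : ℝ => x ^ 2 / 2) atTop atTop :=
      (tendsto_pow_atTop two_ne_zero).atTop_div_const (by norm_num)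
    have h3 := h1.sub (((tendsto_sum_poisson_atTop (k + 1)).comp h2).const_sub 1)
    have hC1 : C * (√(2 * π) / 2 * ((2 * k)! / (2 ^ k * k !))) - (1 - 0) = 0 := by
      rw [hC]
      field_simp
      norm_num
    rwa [hC1] at h3

/-- Lower bound for the Gaussian mass of a symmetric interval by a truncated Poisson mixture. -/
lemma sum_poisson_mul_integral_le (d : ℝ) {a : ℝ} (ha : 0 ≤ a) (N : ℕ) :
    ∑ k ∈ Finset.range N, exp (-(d ^ 2 / 2)) * (d ^ 2 / 2) ^ k / k ! *
      (2 / √(2 * π) * (2 ^ k * k ! / (2 * k)!) *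
        ∫ x in (0 : ℝ)..a, x ^ (2 * k) * exp (-(x ^ 2 / 2))) ≤
      ∫ x in -a..a, gaussianPDFReal d 1 x := by
  have hg : Continuous (gaussianPDFReal d 1) := by
    rw [gaussianPDFReal_def]; fun_prop
  have hsplit : ∫ x in -a..a, gaussianPDFReal d 1 x =
      ∫ x in (0 : ℝ)..a, (gaussianPDFReal d 1 (-x) + gaussianPDFReal d 1 x) := by
    rw [intervalIntegral.integral_add ((by fun_prop : Continuous _).intervalIntegrable _ _)
      (hg.intervalIntegrable _ _), intervalIntegral.integral_comp_neg, neg_zero,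
      intervalIntegral.integral_add_adjacent_intervals (hg.intervalIntegrable _ _)
      (hg.intervalIntegrable _ _)]
  rw [hsplit]
  simp_rw [← intervalIntegral.integral_const_mul]
  rw [← intervalIntegral.integral_finsetSum
    fun k _ => (by fun_prop : Continuous _).intervalIntegrable _ _]
  refine intervalIntegral.integral_mono_on ha
    ((by fun_prop : Continuous _).intervalIntegrable _ _)
    ((by fun_prop : Continuous _).intervalIntegrable _ _) fun x _ => ?_
  have hpdf : gaussianPDFReal d 1 (-x) + gaussianPDFReal d 1 x =
      2 / √(2 * π) * exp (-(d ^ 2 / 2)) * exp (-(x ^ 2 / 2)) * cosh (d * x) := by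
    simp only [gaussianPDFReal, NNReal.coe_one, mul_one, cosh_eq]
    rw [show -(-x - d) ^ 2 / 2 = -(d ^ 2 / 2) + -(x ^ 2 / 2) + -(d * x) by ring,
      show -(x - d) ^ 2 / 2 = -(d ^ 2 / 2) + -(x ^ 2 / 2) + d * x by ring]
    simp only [exp_add]
    field_simp
    ring
  rw [hpdf]
  have hcosh := sum_le_hasSum (Finset.range N)
    (fun k _ => div_nonneg ((even_two_mul k).pow_nonneg (d * x)) (Nat.cast_nonneg _))
    (hasSum_cosh (d * x))
  refine le_of_eq_of_le ?_ (mul_le_mul_of_nonneg_left hcosh (by positivity))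
  rw [Finset.mul_sum]
  refine Finset.sum_congr rfl fun k _ => ?_
  rw [div_pow, ← pow_mul, mul_pow]
  field_simp

lemma sum_ite_poisson_le (r : ℝ≥0) (k N : ℕ) :
    ∑ j ∈ Finset.range N, (if (j : ℤ) - (k : ℤ) ≥ 2 then exp (-r) * (r : ℝ) ^ j / j ! else 0) ≤
      1 - ∑ j ∈ Finset.range (k + 1), exp (-r) * (r : ℝ) ^ j / j ! := by
  rw [← Finset.sum_filter, le_sub_iff_add_le, ← Finset.sum_union]
  · exact sum_le_hasSum _ (fun _ _ => by positivity) (hasSum_one_poissonMeasure r)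
  · rw [Finset.disjoint_left]
    intro j hj hj'
    simp only [Finset.mem_filter, Finset.mem_range] at hj hj'
    omega

lemma tsum_tsum_ite_poisson_le (d : ℝ) {a : ℝ} (ha : 0 ≤ a) (r t : ℝ≥0)
    (hr : (r : ℝ) = a ^ 2 / 2) (ht : (t : ℝ) = d ^ 2 / 2) :
    ∑' (j : ℕ) (k : ℕ), (if (j : ℤ) - (k : ℤ) ≥ 2 then
      (exp (-r) * (r : ℝ) ^ j / j !) * (exp (-t) * (t : ℝ) ^ k / k !) else 0) ≤
      ∫ x in -a..a, gaussianPDFReal d 1 x := by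
  refine Real.tsum_le_of_sum_range_le
    (fun j => tsum_nonneg fun k => by split_ifs <;> positivity) fun N => ?_
  have hinner (j : ℕ) (hj : j ∈ Finset.range N) :=
    tsum_eq_sum (f := fun k : ℕ => if (j : ℤ) - (k : ℤ) ≥ 2 then
      (exp (-r) * (r : ℝ) ^ j / j !) * (exp (-t) * (t : ℝ) ^ k / k !) else 0)
      (L := SummationFilter.unconditional ℕ) (s := Finset.range N) (fun k hk => if_neg (by
        simp only [Finset.mem_range] at hj hk
        omega))
  rw [Finset.sum_congr rfl hinner, Finset.sum_comm]
  refine le_trans (Finset.sum_le_sum fun k _ => ?_) (sum_poisson_mul_integral_le d ha N)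
  rw [← ht]
  refine le_trans (le_of_eq ?_) (mul_le_mul_of_nonneg_left
    ((sum_ite_poisson_le r k N).trans (by
      rw [hr]; exact one_sub_sum_poisson_le_integral k ha)) (by positivity))
  rw [Finset.mul_sum]
  refine Finset.sum_congr rfl fun j _ => ?_
  split_ifs <;> ring

lemma gaussianReal_abs_sub_lt (s : ℝ≥0) (hs : 0 < (s : ℝ)) (c : ℝ) {Δ : ℝ} (hΔ : 0 < Δ) :
    (gaussianReal 0 s {x | |x - c| < Δ}).toReal =
      ∫ x in -(Δ / √s)..(Δ / √s), gaussianPDFReal (-c / √s) 1 x := by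
  have hσ : 0 < √(s : ℝ) := Real.sqrt_pos.2 hs
  have hmap : (gaussianReal 0 s).map (fun x => (x - c) / √s) = gaussianReal (-c / √s) 1 := by
    have h := Measure.map_map (μ := gaussianReal 0 s) (g := (· / √(s : ℝ))) (f := (· - c))
      (by fun_prop) (by fun_prop)
    rw [gaussianReal_map_sub_const, gaussianReal_map_div_const, zero_sub] at h
    change _ = (gaussianReal 0 s).map (fun x => (x - c) / √s) at h
    rw [← h]
    congr 1
    ext
    simp [Real.sq_sqrt hs.le, hs.ne']
  have hset : {x : ℝ | |x - c| < Δ} =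
      (fun x => (x - c) / √(s : ℝ)) ⁻¹' Ioo (-(Δ / √s)) (Δ / √s) := by
    ext x
    simp only [mem_ofPred_eq, mem_preimage, mem_Ioo, ← abs_lt, abs_div, abs_of_pos hσ]
    exact (div_lt_div_iff_of_pos_right hσ).symm
  have hle : -(Δ / √(s : ℝ)) ≤ Δ / √s := by
    have : 0 < Δ / √(s : ℝ) := by positivity
    linarith
  rw [hset, ← Measure.map_apply (by fun_prop) measurableSet_Ioo, hmap,
    gaussianReal_apply_eq_integral _ one_ne_zero, ENNReal.toReal_ofReal
      (integral_nonneg fun x => gaussianPDFReal_nonneg _ _ x),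
    intervalIntegral.integral_of_le hle, integral_Ioc_eq_integral_Ioo]

/-- If `v'β ~ N(0, v'Σv)` with `v'Σv > 0`, then
`P(|v'β − c| < Δ) ≥ P(X − Y ≥ 2)` where `X ~ Poisson(Δ²/(2 v'Σv))` and
`Y ~ Poisson(c²/(2 v'Σv))` are independent (the probability of the independent
pair is written as an explicit double sum over the joint Poisson pmf). -/
theorem gaussian_linear_functional_poisson_bound {m : ℕ}
    (P : Measure (Fin m → ℝ)) [IsProbabilityMeasure P]
    (S : Matrix (Fin m) (Fin m) ℝ) (hS : S.PosSemidef)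
    (v : Fin m → ℝ) (c Δ : ℝ) (hΔ : 0 < Δ)
    (s : ℝ≥0) (hs_pos : 0 < (s : ℝ)) (hs : (s : ℝ) = v ⬝ᵥ S.mulVec v)
    (hmap : P.map (fun b => v ⬝ᵥ b) = gaussianReal 0 s) :
    (P {b | |v ⬝ᵥ b - c| < Δ}).toReal
      ≥ ∑' (j : ℕ) (k : ℕ),
          (if (j : ℤ) - (k : ℤ) ≥ 2 then
            poissonPMFReal ⟨Δ ^ 2 / (2 * s), by positivity⟩ j
              * poissonPMFReal ⟨c ^ 2 / (2 * s), by positivity⟩ k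
          else 0) := by
  have hset : MeasurableSet {x : ℝ | |x - c| < Δ} :=
    (isOpen_lt (by fun_prop) continuous_const).measurableSet
  have hprob : P {b | |v ⬝ᵥ b - c| < Δ} = gaussianReal 0 s {x | |x - c| < Δ} := by
    rw [← hmap, Measure.map_apply (by unfold dotProduct; fun_prop) hset]
    rfl
  rw [hprob, gaussianReal_abs_sub_lt s hs_pos c hΔ]
  refine tsum_tsum_ite_poisson_le (-c / √s) (by positivity) _ _ ?_ ?_
  · change Δ ^ 2 / (2 * (s : ℝ)) = _
    rw [div_pow, Real.sq_sqrt hs_pos.le, div_div, mul_comm]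
  · change c ^ 2 / (2 * (s : ℝ)) = _
    rw [div_pow, Real.sq_sqrt hs_pos.le, div_div, mul_comm, neg_sq]
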